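/- Let n ≥ 3 be an integer, p_1,…,p_r positive integers with Σ_j p_j = 2T, and K ≥ 1 a real number. Consider the instance with n agents and items o_1,…,o_{r+n−1}, where for each agent i ∈ {1,…,n−1}: c_i(o_j) = p_j/K for 1 ≤ j ≤ r, c_i(o_{r+1}) = c_i(o_{r+2}) = rT, and c_i(o_j) = T/K for r+3 ≤ j ≤ r+n−1; and for agent n: c_n(o_j) = 2T for 1 ≤ j ≤ r and c_n(o_j) = T/K for r+1 ≤ j ≤ r+n−1 (so each agent's total cost is (2r + (n−1)/K)·T). Then: (a) if there is a partition of {1,…,r} into I₁, I₂ with Σ_{j∈I₁} p_j = Σ_{j∈I₂} p_j = T, then the allocation A₁ = {o_j : j ∈ I₁}, A₂ = {o_j : j ∈ I₂}, A_n = {o_{r+1}, o_{r+2}}, with each of agents 3,…,n−1 receiving exactly one of o_{r+3},…,o_{r+n−1}, is EQ1 and has social cost (n+1)T/K; and (b) if no such partition exists, then every EQ1 allocation of this instance has social cost at least (r + n/K)·T. -/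

import Mathlib

open Finset

/-- `A` is an allocation: the bundles are pairwise disjoint and every item is assigned. -/
def IsAllocation {n : ℕ} {ι : Type*} (A : Fin n → Finset ι) : Prop :=
  (∀ i j : Fin n, i ≠ j → Disjoint (A i) (A j)) ∧ ∀ o : ι, ∃ i : Fin n, o ∈ A i

/-- The social cost of an allocation. -/
def SC {n : ℕ} {ι : Type*} (c : Fin n → ι → ℝ) (A : Fin n → Finset ι) : ℝ :=
  ∑ i, ∑ o ∈ A i, c i o

/-- Equitability up to one item. -/
def EQ1 {n : ℕ} {ι : Type*} [DecidableEq ι] (c : Fin n → ι → ℝ)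
    (A : Fin n → Finset ι) : Prop :=
  ∀ i j : Fin n, ∃ S ⊆ A i, S.card ≤ 1 ∧ ∑ o ∈ A i \ S, c i o ≤ ∑ o ∈ A j, c j o

/-- Items are `Fin r ⊕ Fin (n-1)`: `Sum.inl j` is `o_{j+1}` (`j < r`) and `Sum.inr k` is
`o_{r+k+1}`.  Agents `1,…,n-1` (indices `< n-1`) have cost `p_j/K` on `o_j`, cost `rT` on
`o_{r+1}, o_{r+2}` and `T/K` on the remaining items; agent `n` (index `n-1`) has cost `2T`
on every `o_j` with `j ≤ r` and `T/K` on all other items. -/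
noncomputable def cEQ1H (n r T : ℕ) (p : Fin r → ℕ) (K : ℝ) (i : Fin n) :
    Fin r ⊕ Fin (n - 1) → ℝ := fun o =>
  match o with
  | Sum.inl j => if (i : ℕ) = n - 1 then 2 * (T : ℝ) else (p j : ℝ) / K
  | Sum.inr k =>
      if (i : ℕ) = n - 1 then (T : ℝ) / K
      else (if (k : ℕ) ≤ 1 then (r : ℝ) * T else (T : ℝ) / K)

theorem IsAllocation.exists_owner {n : ℕ} {ι : Type*} [Fintype ι]
    {A : Fin n → Finset ι} (hA : IsAllocation A) :
    ∃ f : ι → Fin n, ∀ i, A i = Finset.univ.filter (fun o => f o = i) := by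
  choose f hf using hA.2
  refine ⟨f, fun i => ?_⟩
  ext o
  simp only [mem_filter, mem_univ, true_and]
  refine ⟨fun ho => ?_, fun h => h ▸ hf o⟩
  by_contra hne
  exact disjoint_left.mp (hA.1 _ _ hne) (hf o) ho

theorem sum_fin_ite_le_one (n : ℕ) (hn : 3 ≤ n) (x : ℝ) :
    ∑ k : Fin (n - 1), (if (k : ℕ) ≤ 1 then 0 else x) = ((n : ℝ) - 3) * x := by
  obtain ⟨m, rfl⟩ := Nat.exists_eq_add_of_le' hn
  change ∑ k : Fin (m + 2), (if (k : ℕ) ≤ 1 then 0 else x) = _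
  rw [Fin.sum_univ_succ, Fin.sum_univ_succ]
  simp

theorem eq1_and_SC_of_balanced {n r T : ℕ} (hn : 3 ≤ n) {p : Fin r → ℕ} {K : ℝ} (hK : 0 < K)
    {I : Finset (Fin r)} (hI : ∑ j ∈ I, p j = T) (hI' : ∑ j ∈ Iᶜ, p j = T)
    {A : Fin n → Finset (Fin r ⊕ Fin (n - 1))}
    (h0 : A ⟨0, by omega⟩ = I.image Sum.inl)
    (h1 : A ⟨1, by omega⟩ = Iᶜ.image Sum.inl)
    (hl : A ⟨n - 1, by omega⟩ =
      {Sum.inr (⟨0, by omega⟩ : Fin (n - 1)), Sum.inr (⟨1, by omega⟩ : Fin (n - 1))})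
    (hmid : ∀ i : Fin n, 2 ≤ (i : ℕ) → (i : ℕ) < n - 1 →
      ∃ k : Fin (n - 1), 2 ≤ (k : ℕ) ∧ A i = {Sum.inr k}) :
    EQ1 (cEQ1H n r T p K) A ∧ SC (cEQ1H n r T p K) A = ((n : ℝ) + 1) * T / K := by
  have hTK : (0 : ℝ) ≤ T / K := by positivity
  have hinl : ∀ (i : Fin n) (J : Finset (Fin r)), (i : ℕ) ≠ n - 1 → ∑ j ∈ J, p j = T →
      ∑ o ∈ J.image Sum.inl, cEQ1H n r T p K i o = T / K := by
    intro i J hi hJ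
    rw [Finset.sum_image Sum.inl_injective.injOn]
    simp only [cEQ1H, hi, if_false]
    rw [← Finset.sum_div, ← hJ]
    push_cast
    rfl
  have hcost : ∀ i : Fin n, ∑ o ∈ A i, cEQ1H n r T p K i o =
      T / K + if i = ⟨n - 1, by omega⟩ then (T : ℝ) / K else 0 := by
    intro i
    by_cases hi : (i : ℕ) = n - 1
    · rw [show i = ⟨n - 1, by omega⟩ from Fin.ext hi, hl, Finset.sum_pair (by simp)]
      simp [cEQ1H]
    · rw [if_neg (fun h => hi (congrArg Fin.val h)), add_zero]
      rcases lt_or_ge (i : ℕ) 2 with hlt | hge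
      · rcases Nat.le_one_iff_eq_zero_or_eq_one.mp (Nat.lt_succ_iff.mp hlt) with hz | hz
        · rw [show A i = _ from (congrArg A (Fin.ext hz)).trans h0]
          exact hinl _ _ hi hI
        · rw [show A i = _ from (congrArg A (Fin.ext hz)).trans h1]
          exact hinl _ _ hi hI'
      · obtain ⟨k, hk, hAk⟩ := hmid i hge (by omega)
        rw [hAk, Finset.sum_singleton]
        simp [cEQ1H, hi, show ¬ (k : ℕ) ≤ 1 by omega]
  have hge : ∀ j : Fin n, (T : ℝ) / K ≤ ∑ o ∈ A j, cEQ1H n r T p K j o := by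
    intro j
    rw [hcost j]
    split_ifs <;> linarith
  refine ⟨fun i j => ?_, ?_⟩
  · by_cases hi : i = ⟨n - 1, by omega⟩
    · subst hi
      refine ⟨{Sum.inr ⟨0, by omega⟩}, by simp [hl], by simp, le_trans (le_of_eq ?_) (hge j)⟩
      rw [hl, Finset.sum_sdiff_eq_sub (by simp), Finset.sum_pair (by simp)]
      simp [cEQ1H]
    · refine ⟨∅, by simp, by simp, ?_⟩
      rw [Finset.sdiff_empty, hcost i, if_neg hi, add_zero]
      exact hge j
  · unfold SC
    rw [Finset.sum_congr rfl fun i _ => hcost i, Finset.sum_add_distrib]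
    simp
    ring

theorem SC_eq_sum_owner {n : ℕ} {ι : Type*} [Fintype ι] (c : Fin n → ι → ℝ)
    {A : Fin n → Finset ι} {f : ι → Fin n}
    (hf : ∀ i, A i = Finset.univ.filter (fun o => f o = i)) :
    SC c A = ∑ o, c (f o) o := by
  unfold SC
  rw [← Finset.sum_fiberwise Finset.univ f]
  refine Finset.sum_congr rfl fun i _ => ?_
  rw [hf i]
  refine Finset.sum_congr rfl fun o ho => ?_
  rw [(Finset.mem_filter.mp ho).2]

theorem le_sum_cost_of_expensive {n r T : ℕ} (hr : 1 ≤ r) {p : Fin r → ℕ}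
    (hsum : ∑ j, p j = 2 * T) {K : ℝ} (hK : 1 ≤ K) (hn : 1 ≤ n)
    (f : Fin r ⊕ Fin (n - 1) → Fin n) {k₀ : Fin (n - 1)} (hk₀ : (k₀ : ℕ) ≤ 1)
    (hfk : (f (Sum.inr k₀) : ℕ) ≠ n - 1) :
    ((r : ℝ) + n / K) * T ≤ ∑ o, cEQ1H n r T p K (f o) o := by
  have hK0 : 0 < K := by linarith
  have hsumR : ∑ j, (p j : ℝ) = 2 * T := by exact_mod_cast hsum
  have hTK : (T : ℝ) / K ≤ r * T := by
    have h1 : (T : ℝ) / K ≤ T := div_le_self (by positivity) hK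
    have h2 : (T : ℝ) ≤ r * T := by exact_mod_cast Nat.le_mul_of_pos_left T hr
    linarith
  have hinl : ∑ j, (p j : ℝ) / K ≤ ∑ j, cEQ1H n r T p K (f (Sum.inl j)) (Sum.inl j) := by
    refine Finset.sum_le_sum fun j _ => ?_
    have hpj : (p j : ℝ) ≤ 2 * T := by
      rw [← hsumR]
      exact Finset.single_le_sum (f := fun j => (p j : ℝ))
        (fun _ _ => by positivity) (Finset.mem_univ j)
    have := div_le_self (show (0 : ℝ) ≤ p j by positivity) hK
    simp only [cEQ1H]
    split_ifs <;> linarith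
  have hinr : ∑ k : Fin (n - 1), ((T : ℝ) / K + if k = k₀ then r * T - (T : ℝ) / K else 0) ≤
      ∑ k, cEQ1H n r T p K (f (Sum.inr k)) (Sum.inr k) := by
    refine Finset.sum_le_sum fun k _ => ?_
    by_cases hk : k = k₀
    · subst hk
      simp [cEQ1H, hfk, hk₀]
    · simp only [cEQ1H, hk, if_false]
      split_ifs <;> linarith
  rw [← Finset.sum_div, hsumR] at hinl
  rw [Finset.sum_add_distrib] at hinr
  simp only [Finset.sum_const, Finset.card_univ, Fintype.card_fin, nsmul_eq_mul,
    Finset.sum_ite_eq', Finset.mem_univ, if_true, Nat.cast_sub hn, Nat.cast_one] at hinr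
  rw [Fintype.sum_sum_type]
  have : ((r : ℝ) + n / K) * T = 2 * T / K + (((n : ℝ) - 1) * (T / K) + (r * T - T / K)) := by
    ring
  linarith

theorem exists_partition_of_eq1 {n r T : ℕ} (hn : 3 ≤ n) {p : Fin r → ℕ}
    (hsum : ∑ j, p j = 2 * T) {K : ℝ} (hK : 0 < K)
    {B : Fin n → Finset (Fin r ⊕ Fin (n - 1))} (hE : EQ1 (cEQ1H n r T p K) B)
    {f : Fin r ⊕ Fin (n - 1) → Fin n}
    (hf : ∀ i, B i = Finset.univ.filter (fun o => f o = i))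
    (hbig : ∀ k : Fin (n - 1), (k : ℕ) ≤ 1 → (f (Sum.inr k) : ℕ) = n - 1) :
    ∃ I : Finset (Fin r), ∑ j ∈ I, p j = T := by
  classical
  set l : Fin n := ⟨n - 1, by omega⟩ with hl
  have hTK : (0 : ℝ) ≤ T / K := by positivity
  have hsumR : ∑ j, (p j : ℝ) = 2 * T := by exact_mod_cast hsum
  have hnonneg : ∀ i o, 0 ≤ cEQ1H n r T p K i o := by
    rintro i (j | k) <;> simp only [cEQ1H] <;> split_ifs <;> positivity
  have hlow : ∀ i, (T : ℝ) / K ≤ ∑ o ∈ B i, cEQ1H n r T p K i o := by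
    intro i
    obtain ⟨S, -, hS1, hS⟩ := hE l i
    refine le_trans ?_ hS
    obtain ⟨k, hk, hkS⟩ : ∃ k : Fin (n - 1), (k : ℕ) ≤ 1 ∧ Sum.inr k ∉ S := by
      by_contra! h
      have := Finset.card_le_one.mp hS1 _ (h ⟨0, by omega⟩ (by simp)) _
        (h ⟨1, by omega⟩ (by simp))
      simp at this
    have hmem : Sum.inr k ∈ B l \ S := by
      rw [Finset.mem_sdiff, hf l]
      exact ⟨Finset.mem_filter.mpr ⟨Finset.mem_univ _, Fin.ext (hbig k hk)⟩, hkS⟩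
    have := Finset.single_le_sum (fun o _ => hnonneg l o) hmem
    simpa [cEQ1H, hl] using this
  let h : Fin r ⊕ Fin (n - 1) → ℝ :=
    Sum.elim (fun j => (p j : ℝ) / K) (fun k => if (k : ℕ) ≤ 1 then 0 else (T : ℝ) / K)
  have hh0 : ∀ o, 0 ≤ h o := by
    rintro (j | k) <;> simp only [h, Sum.elim_inl, Sum.elim_inr]
    · positivity
    · split_ifs <;> positivity
  have hcost : ∀ i, i ≠ l → ∑ o ∈ B i, cEQ1H n r T p K i o = ∑ o ∈ B i, h o := by
    intro i hi
    have hi' : (i : ℕ) ≠ n - 1 := fun h => hi (Fin.ext h)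
    refine Finset.sum_congr rfl fun o ho => ?_
    rw [hf i, Finset.mem_filter] at ho
    rcases o with j | k
    · simp [cEQ1H, h, hi']
    · have hk : ¬ (k : ℕ) ≤ 1 := fun hk => hi' (ho.2 ▸ hbig k hk)
      simp [cEQ1H, h, hi', hk]
  have htotal : ∑ i, ∑ o ∈ B i, h o = ((n : ℝ) - 1) * (T / K) := by
    have : ∑ i, ∑ o ∈ B i, h o = ∑ o, h o := SC_eq_sum_owner (fun _ => h) hf
    rw [this, Fintype.sum_sum_type]
    simp only [h, Sum.elim_inl, Sum.elim_inr]
    rw [sum_fin_ite_le_one n hn, ← Finset.sum_div, hsumR]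
    ring
  obtain ⟨i, hil, hi⟩ : ∃ i, i ≠ l ∧ ∀ k, f (Sum.inr k) ≠ i := by
    by_contra! hcon
    have hsurj : Function.Surjective (fun k => f (Sum.inr k)) := by
      intro i
      by_cases hil : i = l
      · exact ⟨⟨0, by omega⟩, (Fin.ext (hbig ⟨0, by omega⟩ (by simp))).trans hil.symm⟩
      · exact hcon i hil
    have := Fintype.card_le_of_surjective _ hsurj
    simp only [Fintype.card_fin] at this
    omega
  have hupper : ∑ o ∈ B i, h o ≤ T / K := by
    have hrest : ((n : ℝ) - 2) * (T / K) ≤ ∑ i' ∈ (Finset.univ.erase l).erase i,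
        ∑ o ∈ B i', h o := by
      have hcard : (((Finset.univ.erase l).erase i).card : ℝ) = (n : ℝ) - 2 := by
        rw [Finset.card_erase_of_mem (by simp [hil]), Finset.card_erase_of_mem (by simp),
          Finset.card_univ, Fintype.card_fin, Nat.sub_sub, Nat.cast_sub (by omega)]
        norm_num
      rw [← hcard, ← nsmul_eq_mul]
      refine Finset.card_nsmul_le_sum _ _ _ fun i' hi' => ?_
      rw [← hcost i' (by simp at hi'; exact hi'.2)]
      exact hlow i'
    have hlast : 0 ≤ ∑ o ∈ B l, h o := Finset.sum_nonneg fun o _ => hh0 o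
    rw [← Finset.add_sum_erase _ _ (Finset.mem_univ l),
      ← Finset.add_sum_erase (Finset.univ.erase l) _ (by simp [hil] : i ∈ _)] at htotal
    linarith
  have heq : ∑ o ∈ B i, h o = T / K := le_antisymm hupper (hcost i hil ▸ hlow i)
  refine ⟨Finset.univ.filter (fun j => f (Sum.inl j) = i), ?_⟩
  rw [hf i, Finset.sum_filter, Fintype.sum_sum_type] at heq
  simp only [hi, if_false, Finset.sum_const_zero, add_zero, h, Sum.elim_inl] at heq
  rw [← Finset.sum_filter, ← Finset.sum_div, div_left_inj' hK.ne'] at heq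
  exact_mod_cast heq

theorem eq1_hardness_instance (n r T : ℕ) (hn : 3 ≤ n) (p : Fin r → ℕ)
    (hp : ∀ j, 0 < p j) (hsum : ∑ j, p j = 2 * T) (K : ℝ) (hK : 1 ≤ K) :
    ((∀ I : Finset (Fin r), ∑ j ∈ I, p j = T → ∑ j ∈ Iᶜ, p j = T →
      ∀ A : Fin n → Finset (Fin r ⊕ Fin (n - 1)), IsAllocation A →
        A ⟨0, by omega⟩ = I.image Sum.inl →
        A ⟨1, by omega⟩ = Iᶜ.image Sum.inl →
        A ⟨n - 1, by omega⟩ =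
          {Sum.inr (⟨0, by omega⟩ : Fin (n - 1)), Sum.inr (⟨1, by omega⟩ : Fin (n - 1))} →
        (∀ i : Fin n, 2 ≤ (i : ℕ) → (i : ℕ) < n - 1 →
          ∃ k : Fin (n - 1), 2 ≤ (k : ℕ) ∧ A i = {Sum.inr k}) →
        EQ1 (cEQ1H n r T p K) A ∧
          SC (cEQ1H n r T p K) A = ((n : ℝ) + 1) * T / K)) ∧
    ((¬ ∃ I : Finset (Fin r), ∑ j ∈ I, p j = T) →
      ∀ B : Fin n → Finset (Fin r ⊕ Fin (n - 1)), IsAllocation B →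
        EQ1 (cEQ1H n r T p K) B →
        ((r : ℝ) + n / K) * T ≤ SC (cEQ1H n r T p K) B) := by
  have hK0 : 0 < K := by linarith
  refine ⟨fun I hI hI' A _ h0 h1 hl hmid => eq1_and_SC_of_balanced hn hK0 hI hI' h0 h1 hl hmid,
    fun hno B hB hE => ?_⟩
  obtain ⟨f, hf⟩ := hB.exists_owner
  have hr : 1 ≤ r := by
    by_contra hr
    obtain rfl : r = 0 := by omega
    exact hno ⟨∅, by simp at hsum ⊢; omega⟩
  rw [SC_eq_sum_owner _ hf]
  by_cases hbig : ∀ k : Fin (n - 1), (k : ℕ) ≤ 1 → (f (Sum.inr k) : ℕ) = n - 1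
  · exact absurd (exists_partition_of_eq1 hn hsum hK0 hE hf hbig) hno
  · push Not at hbig
    obtain ⟨k₀, hk₀, hfk⟩ := hbig
    exact le_sum_cost_of_expensive hr hsum hK (by omega) f hk₀ hfk
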